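/- Let A be the Artin group of type D_4 and let u, v, w ∈ {a,b,c} be pairwise distinct. Let x_1, x_3 be distinct left cosets of A_û, let x_2 be a left coset of A_v̂ and x_4 a left coset of A_ŵ, and suppose x_1 ∩ x_2, x_2 ∩ x_3, x_3 ∩ x_4 and x_4 ∩ x_1 are all nonempty. Then x_2 ∩ x_4 ≠ ∅. (In an embedded 4-cycle of the D_4 Artin complex with all vertex types among {â, b̂, ĉ}, opposite vertices of the same type force the other two opposite vertices, of two remaining distinct types, to be adjacent.) -/

import Mathlib

/-!
The Artin group of type `D₄`, with generators `a, b, c, d`, where `d` is the central node of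
the Dynkin diagram: relations `ada = dad`, `bdb = dbd`, `cdc = dcd`, `ab = ba`, `ac = ca`,
`bc = cb`.
-/

open Pointwise

namespace D4Artin

/-- The generators of the `D₄` Artin group. -/
inductive Gen : Type
  | a | b | c | d
deriving DecidableEq

open Gen

/-- The defining relators of the `D₄` Artin group: a braid relation `sts = tst` whenever one of
`s, t` is the central node `d`, and commutation `st = ts` otherwise. -/
def Rels : Set (FreeGroup Gen) :=
  { r | ∃ s t : Gen, s ≠ t ∧
      (((s = d ∨ t = d) ∧
          r = FreeGroup.of s * FreeGroup.of t * FreeGroup.of s *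
              (FreeGroup.of t * FreeGroup.of s * FreeGroup.of t)⁻¹) ∨
        ((s ≠ d ∧ t ≠ d) ∧
          r = FreeGroup.of s * FreeGroup.of t * (FreeGroup.of s)⁻¹ * (FreeGroup.of t)⁻¹)) }

/-- The Artin group of type `D₄`. -/
abbrev Artin : Type := PresentedGroup Rels

/-- The generators, as elements of the Artin group. -/
def gen (s : Gen) : Artin := PresentedGroup.of s

/-- The standard parabolic subgroup `A_ŝ` generated by the three generators other than `s`. -/
def Ahat (s : Gen) : Subgroup Artin :=
  Subgroup.closure { x | ∃ t : Gen, t ≠ s ∧ x = gen t }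

/-- `X` is a left coset of the subgroup `H`. -/
def IsCosetOf (X : Set Artin) (H : Subgroup Artin) : Prop :=
  ∃ g : Artin, X = g • (H : Set Artin)

end D4Artin

open D4Artin D4Artin.Gen

namespace D4Artin

/-- The right complement of `s` by `t`: `s * comp s t = t * comp t s` is the lcm of `s ≠ t`. -/
def comp (s t : Gen) : List Gen := if s = d ∨ t = d then [t, s] else [t]

/-- Equivalence of positive words, in a form adapted to left cancellation. -/
inductive Equi : List Gen → List Gen → Prop
  | nil : Equi [] []
  | cons (s : Gen) {x y : List Gen} : Equi x y → Equi (s :: x) (s :: y)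
  | braid {s t : Gen} {x y z : List Gen} : s ≠ t → Equi x (comp s t ++ z) →
      Equi y (comp t s ++ z) → Equi (s :: x) (t :: y)

namespace Equi

theorem refl : ∀ x, Equi x x
  | [] => nil
  | s :: x => cons s (refl x)

theorem symm {x y : List Gen} (h : Equi x y) : Equi y x := by
  induction h with
  | nil => exact nil
  | cons s _ ih => exact cons s ih
  | braid hst hx hy _ _ => exact braid hst.symm hy hx

theorem length_comp (s t : Gen) : (comp s t).length = (comp t s).length := by
  cases s <;> cases t <;> rfl

theorem length_eq {x y : List Gen} (h : Equi x y) : x.length = y.length := by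
  induction h with
  | nil => rfl
  | cons s _ ih => simp [ih]
  | @braid s t _ _ _ _ _ _ ihx ihy => simp [ihx, ihy, length_comp s t]

theorem mem_comp (s t r : Gen) : (r = s ∨ r ∈ comp s t) ↔ (r = t ∨ r ∈ comp t s) := by
  cases s <;> cases t <;> cases r <;> decide

theorem mem_iff {x y : List Gen} (h : Equi x y) (r : Gen) : r ∈ x ↔ r ∈ y := by
  induction h with
  | nil => rfl
  | cons s _ ih => simp [ih]
  | @braid s t _ _ _ _ _ _ ihx ihy =>
    simp only [List.mem_cons, ihx, ihy, List.mem_append, ← or_assoc, mem_comp s t]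

theorem append_right {x y : List Gen} (h : Equi x y) (z : List Gen) : Equi (x ++ z) (y ++ z) := by
  induction h with
  | nil => exact refl z
  | cons s _ ih => exact cons s ih
  | @braid s t _ _ p hst _ _ ihx ihy =>
    exact braid (z := p ++ z) hst (by simpa using ihx) (by simpa using ihy)

theorem append_left {x y : List Gen} (z : List Gen) (h : Equi x y) : Equi (z ++ x) (z ++ y) := by
  induction z with
  | nil => exact h
  | cons s _ ih => exact cons s ih

theorem of_cons {s : Gen} {x y : List Gen} (h : Equi (s :: x) (s :: y)) : Equi x y := by
  cases h with
  | cons _ h => exact h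
  | braid h => exact absurd rfl h

theorem of_append {z x y : List Gen} (h : Equi (z ++ x) (z ++ y)) : Equi x y := by
  induction z with
  | nil => exact h
  | cons s _ ih => exact ih (of_cons h)

theorem lcm {s t : Gen} (hst : s ≠ t) {x y : List Gen} (h : Equi (s :: x) (t :: y)) :
    ∃ z, Equi x (comp s t ++ z) ∧ Equi y (comp t s ++ z) := by
  cases h with
  | cons => exact absurd rfl hst
  | braid _ h1 h2 => exact ⟨_, h1, h2⟩

/-- A candidate for the quotient of the second word by the first one. -/
def quot : ℕ → List Gen → List Gen → Option (List Gen)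
  | 0, _, _ => none
  | _ + 1, [], y => some y
  | _ + 1, _ :: _, [] => none
  | n + 1, s :: x, t :: y =>
    if s = t then quot n x y
    else ((quot n (comp t s) y).map (comp s t ++ ·)).bind (quot n x)

/-- A sound test for equivalence of words. -/
def test : ℕ → List Gen → List Gen → Bool
  | 0, _, _ => false
  | _ + 1, [], [] => true
  | _ + 1, _ :: _, [] => false
  | _ + 1, [], _ :: _ => false
  | n + 1, s :: x, t :: y =>
    if s = t then test n x y
    else match quot n (comp t s) y with
      | none => false
      | some z => test n x (comp s t ++ z) && test n y (comp t s ++ z)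

theorem of_test {n : ℕ} : ∀ {x y : List Gen}, test n x y = true → Equi x y := by
  induction n with
  | zero => intro x y h; simp [test] at h
  | succ n ih =>
    intro x y h
    match x, y with
    | [], [] => exact nil
    | _ :: _, [] => simp [test] at h
    | [], _ :: _ => simp [test] at h
    | s :: x, t :: y =>
      by_cases hst : s = t
      · subst hst
        exact cons s (ih (by simpa [test] using h))
      · rw [test, if_neg hst] at h
        split at h
        · simp at h
        · rw [Bool.and_eq_true] at h
          exact braid hst (ih h.1) (ih h.2)


theorem comp_of_leaf {s t : Gen} (hs : s ≠ d) (ht : t ≠ d) : comp s t = [t] := by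
  simp [comp, hs, ht]

theorem comp_left (t : Gen) : comp d t = [t, d] := by simp [comp]

theorem comp_right (s : Gen) : comp s d = [d, s] := by simp [comp]

theorem cube_leaves {r s t : Gen} (hr : r ≠ d) (hs : s ≠ d) (ht : t ≠ d) (hst : s ≠ t)
    {p q : List Gen} (h : Equi (comp r s ++ p) (comp r t ++ q)) :
    ∃ z, Equi p (t :: z) ∧ Equi q (s :: z) := by
  simp only [comp_of_leaf hr hs, comp_of_leaf hr ht, List.singleton_append] at h
  obtain ⟨z, h1, h2⟩ := lcm hst h
  exact ⟨z, by simpa [comp_of_leaf hs ht] using h1, by simpa [comp_of_leaf ht hs] using h2⟩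

/-- Transitivity for words of length less than `n`. -/
def TransBelow (n : ℕ) : Prop :=
  ∀ x y z : List Gen, y.length < n → Equi x y → Equi y z → Equi x z

theorem TransBelow.trans {n : ℕ} (hn : TransBelow n) {x y z : List Gen} (hx : x.length < n)
    (h : Equi x y) (h' : Equi y z) : Equi x z :=
  hn x y z (h.length_eq ▸ hx) h h'

theorem cube_mid {n : ℕ} (hn : TransBelow n) {s t : Gen} (hs : s ≠ d) (ht : t ≠ d)
    (hst : s ≠ t) {p q : List Gen} (h : Equi (comp d s ++ p) (comp d t ++ q))
    (hl : p.length < n) :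
    ∃ z, Equi p (t :: d :: s :: z) ∧ Equi q (s :: d :: t :: z) := by
  simp only [comp_left, List.cons_append, List.nil_append] at h
  obtain ⟨z, h1, h2⟩ := lcm hst h
  simp only [comp_of_leaf hs ht, comp_of_leaf ht hs, List.singleton_append] at h1 h2
  obtain ⟨y1, h3, h4⟩ := lcm ht.symm h1
  obtain ⟨y2, h5, h6⟩ := lcm hs.symm h2
  simp only [comp_left, comp_right, List.cons_append, List.nil_append] at h3 h4 h5 h6
  have hz : Equi (d :: t :: y1) (d :: s :: y2) := by
    refine hn.trans ?_ h4.symm h6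
    have := h1.length_eq
    have := h4.length_eq
    simp only [List.length_cons] at *
    omega
  obtain ⟨z, h7, h8⟩ := lcm hst.symm hz.of_cons
  simp only [comp_of_leaf hs ht, comp_of_leaf ht hs, List.singleton_append] at h7 h8
  have e := h3.length_eq
  have e5 := h5.length_eq
  have e8 := h.length_eq
  refine ⟨z, hn.trans hl h3 (append_left [t, d] h7),
    hn.trans ?_ h5 (append_left [s, d] h8)⟩
  simp only [List.length_cons] at *
  omega

theorem cube_end {n : ℕ} (hn : TransBelow n) {r t : Gen} (hr : r ≠ d) (ht : t ≠ d)
    (hrt : r ≠ t) {p q : List Gen} (h : Equi (comp r d ++ p) (comp r t ++ q))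
    (hl : q.length < n) :
    ∃ z, Equi p (t :: d :: r :: z) ∧ Equi q (d :: t :: r :: d :: z) := by
  simp only [comp_right, comp_of_leaf hr ht, List.cons_append, List.nil_append] at h
  obtain ⟨y, h1, h2⟩ := lcm ht.symm h
  simp only [comp_left, comp_right, List.cons_append, List.nil_append] at h1 h2
  obtain ⟨y1, h3, h4⟩ := lcm hrt h1
  simp only [comp_of_leaf hr ht, comp_of_leaf ht hr, List.singleton_append] at h3 h4
  obtain ⟨z, h5, h6⟩ := lcm hr.symm h4
  simp only [comp_left, comp_right, List.cons_append, List.nil_append] at h5 h6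
  have e := h.length_eq
  have e1 := h3.length_eq
  refine ⟨z, hn.trans ?_ h3 (append_left [t] h6), hn.trans hl h2 (append_left [d, t] h5)⟩
  simp only [List.length_cons] at *
  omega

theorem cube_end_complements {r t : Gen} (hr : r ≠ d) (ht : t ≠ d) (hrt : r ≠ t) :
    Equi [r, d, t, d, r] [t, d, r, d, t] ∧ Equi [r, d, t, r, d] [d, t, r, d, t] := by
  cases r <;> cases t <;> first | contradiction | skip
  all_goals exact ⟨of_test (n := 20) (by decide), of_test (n := 20) (by decide)⟩

theorem cube_mid_complements {s t : Gen} (hs : s ≠ d) (ht : t ≠ d) (hst : s ≠ t) :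
    Equi [d, s, t, d, s] [t, d, s, t, d] := by
  cases s <;> cases t <;> first | contradiction | skip
  all_goals exact of_test (n := 20) (by decide)

theorem cube_leaf_complements {r t : Gen} (hr : r ≠ d) (ht : t ≠ d) (hrt : r ≠ t) :
    Equi [r, t] [t, r] := by
  cases r <;> cases t <;> first | contradiction | skip
  all_goals exact of_test (n := 20) (by decide)

theorem trans_cons_of_end {n : ℕ} (hn : TransBelow n) {r t : Gen} (hr : r ≠ d) (ht : t ≠ d)
    (hrt : r ≠ t) {x z p q : List Gen} (hx : Equi x (comp d r ++ p))
    (hpq : Equi (comp r d ++ p) (comp r t ++ q)) (hz : Equi z (comp t r ++ q))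
    (hlx : x.length < n) (hlz : z.length < n) :
    Equi (d :: x) (t :: z) := by
  have hq : q.length < n := by
    have := hz.length_eq
    simp only [List.length_append] at this
    omega
  obtain ⟨y, h1, h2⟩ := cube_end hn hr ht hrt hpq hq
  have e := cube_end_complements hr ht hrt
  refine braid (z := r :: d :: t :: y) ht.symm ?_ ?_
  · refine hn.trans hlx hx ?_
    rw [comp_left, comp_left]
    have k := append_left [r, d] h1
    refine hn.trans ?_ k (append_right e.1 y)
    have := hx.length_eq
    simp only [comp_left, List.length_append] at this ⊢
    omega
  · refine hn.trans hlz hz ?_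
    rw [comp_right, comp_of_leaf ht hr]
    have k := append_left [r] h2
    refine hn.trans ?_ k (append_right e.2 y)
    have := hz.length_eq
    simp only [comp_of_leaf ht hr, List.length_append] at this ⊢
    omega

theorem transBelow : ∀ n, TransBelow n
  | 0 => fun _ _ _ h => absurd h (Nat.not_lt_zero _)
  | n + 1 => by
    have hn := transBelow n
    intro x y z hl h h'
    have e := h.length_eq
    have e' := h'.length_eq
    cases h with
    | nil => exact h'
    | cons s h =>
      cases h' with
      | cons _ h' => exact cons s (hn.trans (by simp_all) h h')
      | braid hst h1 h2 => exact braid hst (hn.trans (by simp_all) h h1) h2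
    | @braid s r x y p hsr hx hy =>
    cases h' with
    | cons _ h => exact braid hsr hx (hn.trans (by simp_all) h.symm hy)
    | @braid _ t _ z q hrt hy' hz =>
      have hlx : x.length < n := by simp_all
      have hly : y.length < n := by simp_all
      have hlz : z.length < n := by simp_all
      have ex := hx.length_eq
      have ez := hz.length_eq
      have hpq : Equi (comp r s ++ p) (comp r t ++ q) := hn _ _ _ hly hy.symm hy'
      by_cases hst : s = t
      · subst hst
        refine cons s (hn.trans hlx hx (hn.trans (ex ▸ hlx) (append_left _ hpq.of_append) hz.symm))
      by_cases hr : r = d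
      · subst hr
        have hs := hsr
        have ht := hrt.symm
        rw [List.length_append] at ex
        obtain ⟨y, h1, h2⟩ := cube_mid hn hs ht hst hpq (by omega)
        have k1 := append_left (comp s d) h1
        have k2 := append_left (comp t d) h2
        have e1 := cube_mid_complements hs ht hst
        have e2 := cube_mid_complements ht hs (Ne.symm hst)
        refine braid (z := d :: t :: s :: d :: y) hst ?_ ?_
        · refine hn.trans hlx hx (hn.trans (by simpa using ex ▸ hlx) k1 ?_)
          rw [comp_right, comp_of_leaf hs ht]
          refine hn.trans ?_ (append_right e1 y)
            (append_left [t, d] (append_right (cube_leaf_complements hs ht hst) (d :: y)))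
          have := k1.length_eq
          simp [comp_right] at *
          omega
        · refine hn.trans hlz hz (hn.trans (by rw [← ez]; exact hlz) k2 ?_)
          rw [comp_right, comp_of_leaf ht hs]
          refine append_right e2 y
      by_cases hs : s = d
      · subst hs
        exact trans_cons_of_end hn hr (Ne.symm hst) hrt hx hpq hz hlx hlz
      by_cases ht : t = d
      · subst ht
        exact (trans_cons_of_end hn hr hs hsr.symm hz hpq.symm hx hlz hlx).symm
      obtain ⟨y, h1, h2⟩ := cube_leaves hr hs ht hst hpq
      rw [comp_of_leaf hs hr] at hx
      rw [comp_of_leaf ht hr] at hz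
      have k1 := append_left [r] h1
      have k2 := append_left [r] h2
      refine braid (z := r :: y) hst ?_ ?_
      · rw [comp_of_leaf hs ht]
        refine hn.trans hlx hx (hn.trans ?_ k1 (append_right (cube_leaf_complements hr ht hrt) y))
        exact hx.length_eq ▸ hlx
      · rw [comp_of_leaf ht hs]
        refine hn.trans hlz hz (hn.trans ?_ k2
          (append_right (cube_leaf_complements hr hs hsr.symm) y))
        exact hz.length_eq ▸ hlz

theorem trans {x y z : List Gen} (h : Equi x y) (h' : Equi y z) : Equi x z :=
  transBelow (y.length + 1) x y z (Nat.lt_succ_self _) h h'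

end Equi

instance equiSetoid : Setoid (List Gen) where
  r := Equi
  iseqv := ⟨Equi.refl, Equi.symm, Equi.trans⟩

/-- The positive monoid of the `D₄` Artin group. -/
def Monoid₄ : Type := Quotient equiSetoid

namespace Monoid₄

instance : Monoid Monoid₄ where
  mul := Quotient.map₂ (· ++ ·) fun _ _ h _ _ h' =>
    (Equi.append_right h _).trans (Equi.append_left _ h')
  one := Quotient.mk _ []
  mul_assoc := by
    rintro ⟨x⟩ ⟨y⟩ ⟨z⟩
    exact congrArg (Quotient.mk equiSetoid) (List.append_assoc x y z)
  one_mul := by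
    rintro ⟨x⟩
    rfl
  mul_one := by
    rintro ⟨x⟩
    exact congrArg (Quotient.mk equiSetoid) (List.append_nil x)

/-- The class of a word. -/
def mk (x : List Gen) : Monoid₄ := Quotient.mk _ x

theorem mk_append (x y : List Gen) : mk (x ++ y) = mk x * mk y := rfl

theorem mk_nil : mk [] = 1 := rfl

theorem mk_eq_iff {x y : List Gen} : mk x = mk y ↔ Equi x y := Quotient.eq

theorem mul_left_cancel₄ {x y z : Monoid₄} (h : x * y = x * z) : y = z := by
  obtain ⟨x⟩ := x
  obtain ⟨y⟩ := y
  obtain ⟨z⟩ := z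
  exact mk_eq_iff.2 (Equi.of_append (mk_eq_iff.1 h))

/-- A central word divisible by every generator. -/
def fundamental : List Gen := [a, b, c, d, a, b, c, d, a, b, c, d]

theorem exists_mul_eq_fundamental (s : Gen) : ∃ x, mk [s] * x = mk fundamental := by
  have h : ∃ l, Equi ([s] ++ l) fundamental := by
    cases s
    · exact ⟨_, Equi.refl _⟩
    · exact ⟨[a, c, d, a, b, c, d, a, b, c, d], Equi.of_test (n := 20) (by decide)⟩
    · exact ⟨[a, b, d, a, b, c, d, a, b, c, d], Equi.of_test (n := 20) (by decide)⟩
    · exact ⟨[a, b, c, d, a, b, c, d, a, b, c], Equi.of_test (n := 30) (by decide)⟩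
  obtain ⟨l, h⟩ := h
  exact ⟨mk l, mk_eq_iff.2 h⟩

theorem commute_fundamental (x : Monoid₄) : Commute x (mk fundamental) := by
  obtain ⟨x⟩ := x
  change Commute (mk x) _
  induction x with
  | nil => exact Commute.one_left _
  | cons s x ih =>
    refine Commute.mul_left (a := mk [s]) ?_ ih
    refine mk_eq_iff.2 ?_
    cases s <;> exact Equi.of_test (n := 40) (by decide)

theorem commute_of_mem (x : Monoid₄) (t : Submonoid.powers (mk fundamental)) :
    Commute x t := by
  obtain ⟨_, n, rfl⟩ := t
  exact (commute_fundamental x).pow_right n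

instance : OreLocalization.OreSet (Submonoid.powers (mk fundamental)) where
  ore_right_cancel x y t h := ⟨t, by rwa [(commute_of_mem x t).eq, (commute_of_mem y t).eq] at h⟩
  oreNum x _ := x
  oreDenom _ t := t
  ore_eq x t := (commute_of_mem x t).eq.symm

/-- The group of fractions. -/
abbrev Frac : Type := OreLocalization (Submonoid.powers (mk fundamental)) Monoid₄

theorem numeratorHom_injective :
    Function.Injective (OreLocalization.numeratorHom : Monoid₄ →* Frac) := by
  intro x y h
  rw [OreLocalization.numeratorHom_apply, OreLocalization.numeratorHom_apply,
    OreLocalization.oreDiv_eq_iff] at h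
  obtain ⟨p, q, h1, h2⟩ := h
  rw [OneMemClass.coe_one, mul_one, mul_one] at h2
  refine mul_left_cancel₄ (x := q) ?_
  rw [← h2] at h1 ⊢
  exact h1.symm

theorem isUnit_numerator (s : Gen) :
    IsUnit (OreLocalization.numeratorHom (mk [s]) : Frac) := by
  obtain ⟨x, hx⟩ := exists_mul_eq_fundamental s
  obtain ⟨e, he⟩ := OreLocalization.numerator_isUnit
    (⟨mk fundamental, Submonoid.mem_powers _⟩ : Submonoid.powers (mk fundamental))
  have hc := (commute_fundamental (mk [s])).map
    (OreLocalization.numeratorHom : Monoid₄ →* Frac)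
  rw [show OreLocalization.numeratorHom (mk fundamental) = (e : Frac) from he.symm] at hc
  have hm : (OreLocalization.numeratorHom (mk [s]) : Frac) *
      (OreLocalization.numeratorHom x : Frac) = e := by
    rw [← map_mul, hx, he]
  refine isUnit_iff_exists.2 ⟨(OreLocalization.numeratorHom x : Frac) * ↑e⁻¹, ?_, ?_⟩
  · rw [← mul_assoc, hm, Units.mul_inv]
  · have hx' : x * mk [s] = mk fundamental := by
      refine mul_left_cancel₄ (x := mk [s]) ?_
      rw [← mul_assoc, hx, (commute_fundamental (mk [s])).eq]
    rw [mul_assoc, (hc.units_inv_right (u := e)).eq.symm, ← mul_assoc, ← map_mul, hx',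
      show (OreLocalization.numeratorHom (mk fundamental) : Frac) = e from he.symm]
    exact Units.mul_inv e

end Monoid₄

/-- The element of the Artin group represented by a positive word. -/
def wd (l : List Gen) : Artin := (l.map gen).prod

@[simp] theorem wd_nil : wd [] = 1 := rfl

@[simp] theorem wd_cons (s : Gen) (l : List Gen) : wd (s :: l) = gen s * wd l := by simp [wd]

@[simp] theorem wd_append (l l' : List Gen) : wd (l ++ l') = wd l * wd l' := by simp [wd]

theorem gen_braid {s t : Gen} (hst : s ≠ t) (h : s = d ∨ t = d) :
    gen s * (gen t * gen s) = gen t * (gen s * gen t) := by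
  have hr : PresentedGroup.mk Rels (FreeGroup.of s * FreeGroup.of t * FreeGroup.of s *
      (FreeGroup.of t * FreeGroup.of s * FreeGroup.of t)⁻¹) = 1 :=
    PresentedGroup.one_of_mem ⟨s, t, hst, Or.inl ⟨h, rfl⟩⟩
  rw [map_mul, map_inv, mul_inv_eq_one] at hr
  simp only [map_mul, mul_assoc] at hr
  exact hr

theorem gen_comm {s t : Gen} (hs : s ≠ d) (ht : t ≠ d) : gen s * gen t = gen t * gen s := by
  by_cases hst : s = t
  · rw [hst]
  have hr : PresentedGroup.mk Rels (FreeGroup.of s * FreeGroup.of t *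
      (FreeGroup.of s)⁻¹ * (FreeGroup.of t)⁻¹) = 1 :=
    PresentedGroup.one_of_mem ⟨s, t, hst, Or.inr ⟨⟨hs, ht⟩, rfl⟩⟩
  rw [map_mul, map_inv, mul_inv_eq_one, map_mul, map_inv, mul_inv_eq_iff_eq_mul] at hr
  rw [map_mul] at hr
  exact hr

theorem gen_mul_comp {s t : Gen} (hst : s ≠ t) :
    gen s * wd (comp s t) = gen t * wd (comp t s) := by
  by_cases h : s = d ∨ t = d
  · simpa [comp, h, h.symm] using gen_braid hst h
  · have h' : ¬(t = d ∨ s = d) := fun k => h k.symm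
    rw [not_or] at h
    simpa [comp, h, h'] using gen_comm h.1 h.2

theorem wd_eq_of_equi {x y : List Gen} (h : Equi x y) : wd x = wd y := by
  induction h with
  | nil => rfl
  | cons s _ ih => rw [wd_cons, wd_cons, ih]
  | braid hst _ _ ihx ihy =>
    rw [wd_cons, wd_cons, ihx, ihy, wd_append, wd_append, ← mul_assoc, ← mul_assoc,
      gen_mul_comp hst]

/-- The homomorphism to the units of the group of fractions of the positive monoid. -/
noncomputable def toFrac : Artin →* Monoid₄.Fracˣ :=
  PresentedGroup.toGroup (f := fun s => (Monoid₄.isUnit_numerator s).unit) (by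
    rintro _ ⟨s, t, hst, ⟨h, rfl⟩ | ⟨h, rfl⟩⟩
    · rw [map_mul, map_inv, mul_inv_eq_one]
      ext
      simp only [map_mul, FreeGroup.lift_apply_of, Units.val_mul, IsUnit.unit_spec]
      rw [← map_mul, ← map_mul, ← map_mul, ← map_mul]
      refine congrArg _ (Monoid₄.mk_eq_iff.2 ?_)
      cases s <;> cases t <;> first | simp at h; done | simp at hst; done | skip
      all_goals exact Equi.of_test (n := 20) (by decide)
    · rw [map_mul, map_inv, mul_inv_eq_one, map_mul, map_inv, mul_inv_eq_iff_eq_mul]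
      ext
      simp only [map_mul, FreeGroup.lift_apply_of, Units.val_mul, IsUnit.unit_spec]
      rw [← map_mul, ← map_mul]
      refine congrArg _ (Monoid₄.mk_eq_iff.2 ?_)
      cases s <;> cases t <;> first | simp at h; done | simp at hst; done | skip
      all_goals exact Equi.of_test (n := 20) (by decide))

theorem toFrac_wd (l : List Gen) :
    (toFrac (wd l) : Monoid₄.Frac) = OreLocalization.numeratorHom (Monoid₄.mk l) := by
  induction l with
  | nil => rw [wd_nil, map_one, Monoid₄.mk_nil, map_one]; rfl
  | cons s l ih =>
    rw [wd_cons, map_mul, Units.val_mul, ih, ← List.singleton_append, Monoid₄.mk_append, map_mul]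
    congr 1
    rw [toFrac, gen, PresentedGroup.toGroup.of, IsUnit.unit_spec]

theorem wd_eq_iff {x y : List Gen} : wd x = wd y ↔ Equi x y := by
  refine ⟨fun h => ?_, wd_eq_of_equi⟩
  rw [← Monoid₄.mk_eq_iff]
  refine Monoid₄.numeratorHom_injective ?_
  rw [← toFrac_wd, ← toFrac_wd, h]

/-- The elements represented by positive words with letters in `S`. -/
def PosOn (S : Set Gen) (g : Artin) : Prop := ∃ l : List Gen, (∀ s ∈ l, s ∈ S) ∧ wd l = g

/-- The positive elements. -/
abbrev Pos (g : Artin) : Prop := PosOn Set.univ g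

/-- The length homomorphism. -/
def lenHom : Artin →* Multiplicative ℤ :=
  PresentedGroup.toGroup (f := fun _ => Multiplicative.ofAdd 1) (by
    rintro _ ⟨s, t, hst, ⟨h, rfl⟩ | ⟨h, rfl⟩⟩ <;> simp)

/-- The length of an element, as an integer. -/
def len (g : Artin) : ℤ := (lenHom g).toAdd

@[simp] theorem len_one : len 1 = 0 := by simp [len]

@[simp] theorem len_mul (g h : Artin) : len (g * h) = len g + len h := by simp [len]

@[simp] theorem len_gen (s : Gen) : len (gen s) = 1 := by
  simp [len, lenHom, gen]

theorem len_wd (l : List Gen) : len (wd l) = l.length := by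
  induction l with
  | nil => simp
  | cons s l ih => simp [ih, add_comm]

namespace PosOn

variable {S : Set Gen} {g h : Artin}

theorem one : PosOn S 1 := ⟨[], by simp, rfl⟩

theorem mul (hg : PosOn S g) (hh : PosOn S h) : PosOn S (g * h) := by
  obtain ⟨l, hl, rfl⟩ := hg
  obtain ⟨l', hl', rfl⟩ := hh
  refine ⟨l ++ l', fun s hs => ?_, wd_append l l'⟩
  exact (List.mem_append.1 hs).elim (hl s) (hl' s)

theorem of_gen {s : Gen} (hs : s ∈ S) : PosOn S (gen s) := ⟨[s], by simpa using hs, by simp⟩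

theorem pow (hg : PosOn S g) : ∀ n : ℕ, PosOn S (g ^ n)
  | 0 => by simpa using one
  | n + 1 => by simpa [pow_succ] using (hg.pow n).mul hg

theorem mono {S' : Set Gen} (hS : S ⊆ S') (hg : PosOn S g) : PosOn S' g := by
  obtain ⟨l, hl, rfl⟩ := hg
  exact ⟨l, fun s hs => hS (hl s hs), rfl⟩

theorem pos (hg : PosOn S g) : Pos g := hg.mono (Set.subset_univ S)

theorem cases (hg : PosOn S g) : g = 1 ∨ ∃ s ∈ S, ∃ h, PosOn S h ∧ g = gen s * h := by
  obtain ⟨l, hl, rfl⟩ := hg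
  match l with
  | [] => exact Or.inl rfl
  | s :: l =>
    exact Or.inr ⟨s, hl s (by simp), wd l, ⟨l, fun t ht => hl t (by simp [ht]), rfl⟩, wd_cons s l⟩

theorem induction {motive : Artin → Prop} (one : motive 1)
    (mul : ∀ s ∈ S, ∀ h, PosOn S h → motive h → motive (gen s * h)) (hg : PosOn S g) :
    motive g := by
  obtain ⟨l, hl, rfl⟩ := hg
  induction l with
  | nil => exact one
  | cons s l ih =>
    rw [wd_cons]
    have hl' : ∀ t ∈ l, t ∈ S := fun t ht => hl t (by simp [ht])
    exact mul s (hl s (by simp)) _ ⟨l, hl', rfl⟩ (ih hl')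

theorem len_nonneg (hg : PosOn S g) : 0 ≤ len g := by
  obtain ⟨l, _, rfl⟩ := hg
  rw [len_wd]
  positivity

theorem of_mul (hg : Pos g) (hh : Pos h) (hgh : PosOn S (g * h)) : PosOn S g ∧ PosOn S h := by
  obtain ⟨x, _, rfl⟩ := hg
  obtain ⟨y, _, rfl⟩ := hh
  obtain ⟨z, hz, e⟩ := hgh
  rw [← wd_append, wd_eq_iff] at e
  have hm := e.mem_iff
  exact ⟨⟨x, fun s hs => hz s ((hm s).2 (by simp [hs])), rfl⟩,
    ⟨y, fun s hs => hz s ((hm s).2 (by simp [hs])), rfl⟩⟩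

theorem lcm {s t : Gen} (hst : s ≠ t) (hg : Pos g) (hh : Pos h) (e : gen s * g = gen t * h) :
    ∃ z, Pos z ∧ g = wd (comp s t) * z ∧ h = wd (comp t s) * z := by
  obtain ⟨x, _, rfl⟩ := hg
  obtain ⟨y, _, rfl⟩ := hh
  rw [← wd_cons, ← wd_cons, wd_eq_iff] at e
  obtain ⟨z, h1, h2⟩ := e.lcm hst
  exact ⟨wd z, ⟨z, by simp, rfl⟩, by rw [wd_eq_of_equi h1, wd_append],
    by rw [wd_eq_of_equi h2, wd_append]⟩

theorem wd_comp (s t : Gen) : Pos (wd (comp s t)) := ⟨_, by simp, rfl⟩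

theorem mem_closure (hg : PosOn S g) : g ∈ Subgroup.closure (gen '' S) := by
  refine induction (Subgroup.one_mem _) (fun s hs h _ ih => ?_) hg
  exact Subgroup.mul_mem _ (Subgroup.subset_closure ⟨s, hs, rfl⟩) ih

end PosOn

/-- Left divisibility with quotient a positive word in `S`. -/
def LeOn (S : Set Gen) (g h : Artin) : Prop := PosOn S (g⁻¹ * h)

/-- Left divisibility. -/
abbrev Le (g h : Artin) : Prop := LeOn Set.univ g h

namespace LeOn

variable {S : Set Gen} {g h k : Artin}

theorem refl (g : Artin) : LeOn S g g := by simpa [LeOn] using PosOn.one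

theorem trans (h1 : LeOn S g h) (h2 : LeOn S h k) : LeOn S g k := by
  simpa [LeOn, mul_assoc] using PosOn.mul h1 h2

theorem le (h1 : LeOn S g h) : Le g h := h1.pos

theorem mul_left_iff (x : Artin) : LeOn S (x * g) (x * h) ↔ LeOn S g h := by
  simp [LeOn, mul_assoc]

theorem mul_left (x : Artin) (h1 : LeOn S g h) : LeOn S (x * g) (x * h) :=
  (mul_left_iff x).2 h1

theorem mul_right (hk : PosOn S k) (g : Artin) : LeOn S g (g * k) := by
  simpa [LeOn] using hk

theorem one_iff : LeOn S 1 g ↔ PosOn S g := by simp [LeOn]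

theorem mul_iff : LeOn S (g * h) k ↔ LeOn S h (g⁻¹ * k) := by
  simp [LeOn, mul_assoc]

theorem convex (h1 : Le g h) (h2 : Le h k) (h3 : LeOn S g k) : LeOn S g h ∧ LeOn S h k :=
  PosOn.of_mul h1 h2 (by rw [show g⁻¹ * h * (h⁻¹ * k) = g⁻¹ * k by group]; exact h3)

theorem exists_lcm {s t : Gen} (hst : s ≠ t) (hs : Le (gen s) g) (ht : Le (gen t) g) :
    Le (gen s * wd (comp s t)) g := by
  obtain ⟨z, hz, h1, -⟩ := PosOn.lcm (g := (gen s)⁻¹ * g) (h := (gen t)⁻¹ * g) hst hs ht (by simp)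
  refine mul_iff.2 ?_
  rw [h1]
  exact mul_right hz _

/-- The Riesz interpolation property for positive elements. -/
theorem interpolate_pos (n : ℕ) : ∀ {p q e e' : Artin}, len e ≤ n → Pos p → Pos q → Le p e →
    Le q e → Le p e' → Le q e' → ∃ r, Le p r ∧ Le q r ∧ Le r e ∧ Le r e' := by
  induction n with
  | zero =>
    intro p q e e' hn hp hq hpe hqe hpe' hqe'
    rcases hp.cases with rfl | ⟨s, _, p1, hp1, rfl⟩
    · exact ⟨q, one_iff.2 hq, refl q, hqe, hqe'⟩
    · have h1 := PosOn.len_nonneg hpe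
      have h2 := hp1.len_nonneg
      have h3 : len (gen s * p1) + len ((gen s * p1)⁻¹ * e) = len e := by
        rw [← len_mul, mul_inv_cancel_left]
      rw [len_mul, len_gen] at h3
      push_cast at hn
      omega
  | succ n ih =>
    intro p q e e' hn hp hq hpe hqe hpe' hqe'
    rcases hp.cases with rfl | ⟨s, _, p1, hp1, rfl⟩
    · exact ⟨q, one_iff.2 hq, refl q, hqe, hqe'⟩
    rcases hq.cases with rfl | ⟨t, _, q1, hq1, rfl⟩
    · exact ⟨_, refl _, one_iff.2 hp, hpe, hpe'⟩
    have hlen (r : Gen) : len ((gen r)⁻¹ * e) ≤ n := by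
      have : len (gen r) + len ((gen r)⁻¹ * e) = len e := by
        rw [← len_mul, mul_inv_cancel_left]
      rw [len_gen] at this
      push_cast at hn
      omega
    have hse := (mul_right hp1 (gen s)).trans hpe
    have hse' := (mul_right hp1 (gen s)).trans hpe'
    have hte := (mul_right hq1 (gen t)).trans hqe
    have hte' := (mul_right hq1 (gen t)).trans hqe'
    replace hpe := mul_iff.1 hpe
    replace hpe' := mul_iff.1 hpe'
    replace hqe := mul_iff.1 hqe
    replace hqe' := mul_iff.1 hqe'
    by_cases hst : s = t
    · subst hst
      obtain ⟨r, h1, h2, h3, h4⟩ := ih (hlen s) hp1 hq1 hpe hqe hpe' hqe'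
      exact ⟨gen s * r, h1.mul_left _, h2.mul_left _, mul_iff.2 h3, mul_iff.2 h4⟩
    obtain ⟨r1, h1, h2, h3, h4⟩ := ih (hlen s) hp1 (PosOn.wd_comp s t) hpe
      (mul_iff.1 (exists_lcm hst hse hte)) hpe' (mul_iff.1 (exists_lcm hst hse' hte'))
    have hr : gen t * ((gen t)⁻¹ * (gen s * r1)) = gen s * r1 := mul_inv_cancel_left _ _
    have hpos : Pos ((gen t)⁻¹ * (gen s * r1)) := by
      have h5 : Le (gen t * wd (comp t s)) (gen s * r1) := by
        rw [← gen_mul_comp hst]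
        exact h2.mul_left _
      exact (mul_right (PosOn.wd_comp t s) (gen t)).trans h5
    have hle {f : Artin} (hf : Le r1 ((gen s)⁻¹ * f)) :
        Le ((gen t)⁻¹ * (gen s * r1)) ((gen t)⁻¹ * f) :=
      (mul_iff.2 hf).mul_left _
    obtain ⟨r3, k1, k2, k3, k4⟩ := ih (hlen t) hq1 hpos hqe (hle h3) hqe' (hle h4)
    refine ⟨gen t * r3, (h1.mul_left _).trans ?_, k1.mul_left _, mul_iff.2 k3, mul_iff.2 k4⟩
    rw [← hr]
    exact k2.mul_left _

end LeOn

/-- The positive word whose class is the central element of `A_û` used for clearing denominators. -/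
def garside : Gen → List Gen
  | a => [b, d, c, b, d, c, b, d, c, b, d, c]
  | b => [a, d, c, a, d, c, a, d, c, a, d, c]
  | c => [a, d, b, a, d, b, a, d, b, a, d, b]
  | d => []

/-- Data for writing all elements of the subgroup generated by `S` as fractions. -/
structure IsGarside (S : Set Gen) (T : Artin) : Prop where
  commute : ∀ s ∈ S, Commute T (gen s)
  dvd : ∀ s ∈ S, ∃ q, PosOn S q ∧ gen s * q = T
  posOn : PosOn S T

namespace IsGarside

variable {S : Set Gen} {T x : Artin}

theorem commute_of_mem (hT : IsGarside S T) (hx : x ∈ Subgroup.closure (gen '' S)) :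
    Commute T x := by
  induction hx using Subgroup.closure_induction with
  | mem _ h =>
    obtain ⟨s, hs, rfl⟩ := h
    exact hT.commute s hs
  | one => exact Commute.one_right _
  | mul _ _ _ _ h1 h2 => exact h1.mul_right h2
  | inv _ _ h => exact h.inv_right

theorem exists_pow_mul (hT : IsGarside S T) (hx : x ∈ Subgroup.closure (gen '' S)) :
    ∃ n : ℕ, PosOn S (T ^ n * x) := by
  induction hx using Subgroup.closure_induction_left with
  | one => exact ⟨0, by simpa using PosOn.one⟩
  | mul_left y hy z _ ih =>
    obtain ⟨s, hs, rfl⟩ := hy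
    obtain ⟨n, hn⟩ := ih
    refine ⟨n, ?_⟩
    rw [← mul_assoc, ((hT.commute s hs).pow_left n).eq, mul_assoc]
    exact (PosOn.of_gen hs).mul hn
  | inv_mul_cancel y hy z _ ih =>
    obtain ⟨s, hs, rfl⟩ := hy
    obtain ⟨n, hn⟩ := ih
    obtain ⟨q, hq, e⟩ := hT.dvd s hs
    refine ⟨n + 1, ?_⟩
    have h : T ^ (n + 1) * ((gen s)⁻¹ * z) = q * (T ^ n * z) := by
      have hc := ((hT.commute s hs).inv_right).pow_left (n + 1)
      rw [← mul_assoc, hc.eq, pow_succ', ← e]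
      simp [mul_assoc]
    rw [h]
    exact hq.mul hn

theorem exists_lower (hT : IsGarside S T) {e e' : Artin}
    (h : e⁻¹ * e' ∈ Subgroup.closure (gen '' S)) : ∃ f, LeOn S f e ∧ LeOn S f e' := by
  obtain ⟨n, hn⟩ := hT.exists_pow_mul h
  refine ⟨e * (T ^ n)⁻¹, ?_, ?_⟩
  · simpa [LeOn, mul_assoc] using hT.posOn.pow n
  · simpa [LeOn, mul_assoc] using hn

theorem exists_upper (hT : IsGarside S T) {e e' : Artin}
    (h : e⁻¹ * e' ∈ Subgroup.closure (gen '' S)) : ∃ f, LeOn S e f ∧ LeOn S e' f := by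
  obtain ⟨n, hn⟩ := hT.exists_pow_mul h
  refine ⟨e' * T ^ n, ?_, LeOn.mul_right (hT.posOn.pow n) e'⟩
  rw [((hT.commute_of_mem h).pow_left n).eq] at hn
  simpa [LeOn, mul_assoc] using hn

end IsGarside

theorem isGarside_univ : IsGarside Set.univ (wd Monoid₄.fundamental) where
  commute s _ := by
    have h : wd (Monoid₄.fundamental ++ [s]) = wd (s :: Monoid₄.fundamental) := by
      refine wd_eq_of_equi ?_
      cases s <;> exact Equi.of_test (n := 40) (by decide)
    rw [wd_append, wd_cons, wd_cons, wd_nil, mul_one] at h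
    exact h
  dvd s _ := by
    have h : Equi (s :: (Equi.quot 40 [s] Monoid₄.fundamental).getD []) Monoid₄.fundamental := by
      cases s <;> exact Equi.of_test (n := 40) (by decide)
    exact ⟨_, ⟨_, by simp, rfl⟩, by rw [← wd_cons, wd_eq_of_equi h]⟩
  posOn := ⟨_, by simp, rfl⟩

theorem isGarside_compl {u : Gen} (hu : u ≠ d) : IsGarside {s | s ≠ u} (wd (garside u)) where
  commute s hs := by
    have h : wd (garside u ++ [s]) = wd (s :: garside u) := by
      refine wd_eq_of_equi ?_
      cases u <;> cases s <;> first | contradiction | skip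
      all_goals exact Equi.of_test (n := 60) (by decide)
    rw [wd_append, wd_cons, wd_cons, wd_nil, mul_one] at h
    exact h
  dvd s hs := by
    have h : Equi (s :: (Equi.quot 60 [s] (garside u)).getD []) (garside u) := by
      cases u <;> cases s <;> first | contradiction | skip
      all_goals exact Equi.of_test (n := 60) (by decide)
    refine ⟨_, ⟨_, ?_, rfl⟩, by rw [← wd_cons, wd_eq_of_equi h]⟩
    intro r hr
    have := (h.mem_iff r).1 (by simp [hr])
    revert this
    cases u <;> first | contradiction | (cases r <;> simp [garside])
  posOn := by
    refine ⟨_, ?_, rfl⟩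
    intro r hr
    revert hr
    cases u <;> first | contradiction | (cases r <;> simp [garside])

theorem Ahat_eq (u : Gen) : Ahat u = Subgroup.closure (gen '' {s | s ≠ u}) := by
  rw [Ahat]
  congr 1
  ext x
  simp [eq_comm]

theorem closure_gen : Subgroup.closure (gen '' Set.univ) = ⊤ := by
  rw [Set.image_univ]
  exact PresentedGroup.closure_range_of Rels

theorem exists_lower (e e' : Artin) : ∃ f, Le f e ∧ Le f e' :=
  isGarside_univ.exists_lower (by rw [closure_gen]; trivial)

/-- The Riesz interpolation property for left divisibility. -/
theorem interpolate {p q e e' : Artin} (hpe : Le p e) (hqe : Le q e) (hpe' : Le p e')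
    (hqe' : Le q e') : ∃ r, Le p r ∧ Le q r ∧ Le r e ∧ Le r e' := by
  obtain ⟨f, hp, hq⟩ := exists_lower p q
  have hpos : Pos (f⁻¹ * e) := hp.trans hpe
  obtain ⟨r, h1, h2, h3, h4⟩ := LeOn.interpolate_pos (len (f⁻¹ * e)).toNat
    (by simp) hp hq (hpe.mul_left f⁻¹) (hqe.mul_left f⁻¹)
    (hpe'.mul_left f⁻¹) (hqe'.mul_left f⁻¹)
  rw [← mul_inv_cancel_left f p, ← mul_inv_cancel_left f q, ← mul_inv_cancel_left f e,
    ← mul_inv_cancel_left f e']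
  exact ⟨f * r, h1.mul_left f, h2.mul_left f, h3.mul_left f, h4.mul_left f⟩

theorem PosOn.mem_Ahat {u : Gen} {g : Artin} (hg : PosOn {s | s ≠ u} g) : g ∈ Ahat u :=
  Ahat_eq u ▸ hg.mem_closure

theorem gen_mem_Ahat {s u : Gen} (h : s ≠ u) : gen s ∈ Ahat u :=
  PosOn.mem_Ahat (PosOn.of_gen h)

theorem not_posOn_gen {v : Gen} {S : Set Gen} (hv : v ∉ S) : ¬ PosOn S (gen v) := by
  rintro ⟨l, hl, e⟩
  have e' : wd l = wd [v] := by simpa using e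
  exact hv (hl v (((wd_eq_iff.1 e').mem_iff v).2 (by simp)))

theorem PosOn.of_le {S : Set Gen} {g h : Artin} (hg : Pos g) (hh : PosOn S h) (hgh : Le g h) :
    PosOn S g :=
  LeOn.one_iff.1 (LeOn.convex (LeOn.one_iff.2 hg) hgh (LeOn.one_iff.2 hh)).1

theorem LeOn.comp_le {s t : Gen} (hst : s ≠ t) {h : Artin} (hh : Pos h)
    (hs : Le (gen s) (gen t * h)) : Le (wd (comp t s)) h :=
  (mul_left_iff _).1 (exists_lcm hst.symm (mul_right hh _) hs)

theorem PosOn.comp {S : Set Gen} {s t : Gen} (hs : s ∈ S) (ht : t ∈ S) :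
    PosOn S (wd (comp s t)) := by
  refine ⟨_, fun r hr => ?_, rfl⟩
  unfold D4Artin.comp at hr
  split at hr <;> simp at hr <;> aesop

theorem len_inv_gen_mul (s : Gen) (g : Artin) : len ((gen s)⁻¹ * g) = len g - 1 := by
  have h : len (gen s) + len ((gen s)⁻¹ * g) = len g := by rw [← len_mul, mul_inv_cancel_left]
  rw [len_gen] at h
  omega

/-- A left divisor in `S` of `x * k` divides `x`, if `x` has letters in `S` and no letter in `S`
divides `k`. -/
theorem le_of_le_mul {S : Set Gen} {k : Artin} (hk : Pos k) (hS : ∀ s ∈ S, ¬ Le (gen s) k)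
    (n : ℕ) : ∀ {x y : Artin}, len x < n → PosOn S x → PosOn S y → Le y (x * k) → Le y x := by
  induction n with
  | zero =>
    intro x y hn hx
    have := hx.len_nonneg
    push_cast at hn
    omega
  | succ n ih =>
    intro x y hn hx hy hle
    rcases hy.cases with rfl | ⟨s, hs, y1, hy1, rfl⟩
    · exact LeOn.one_iff.2 hx.pos
    have hsx := (LeOn.mul_right hy1.pos (gen s)).trans hle
    have key : LeOn S (gen s) x := by
      rcases hx.cases with rfl | ⟨t, ht, x1, hx1, rfl⟩
      · exact absurd (by simpa using hsx) (hS s hs)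
      by_cases hst : s = t
      · subst hst
        exact LeOn.mul_right hx1 _
      rw [mul_assoc] at hsx
      have h1 := ih (by simp at hn; omega) hx1 (PosOn.comp ht hs)
        (LeOn.comp_le hst (hx1.pos.mul hk) hsx)
      have h2 := (LeOn.mul_right (PosOn.wd_comp s t) (gen s)).trans
        ((gen_mul_comp hst) ▸ h1.mul_left (gen t))
      exact (LeOn.convex (LeOn.one_iff.2 (PosOn.of_gen (Set.mem_univ s))) h2
        (LeOn.one_iff.2 hx)).2
    have h3 := LeOn.mul_iff.1 hle
    rw [← mul_assoc] at h3
    refine LeOn.mul_iff.2 (ih ?_ key hy1 h3)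
    rw [len_inv_gen_mul]
    push_cast at hn
    omega

/-- Splitting off the largest left divisor with letters in `S`. -/
theorem exists_peel (S : Set Gen) {T : Set Gen} (n : ℕ) : ∀ {k : Artin}, len k < n → PosOn T k →
    ∃ h k', PosOn T h ∧ PosOn S h ∧ PosOn T k' ∧ k = h * k' ∧ ∀ s ∈ S, ¬ Le (gen s) k' := by
  induction n with
  | zero =>
    intro k hn hk
    have := hk.len_nonneg
    push_cast at hn
    omega
  | succ n ih =>
    intro k hn hk
    by_cases h : ∃ s ∈ S, Le (gen s) k
    · obtain ⟨s, hs, hle⟩ := h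
      have hc := PosOn.of_mul (PosOn.of_gen (Set.mem_univ s)) hle (by simpa using hk)
      obtain ⟨h, k', h1, h2, h3, h4, h5⟩ := ih (k := (gen s)⁻¹ * k)
        (by rw [len_inv_gen_mul]; push_cast at hn; omega) hc.2
      exact ⟨gen s * h, k', hc.1.mul h1, (PosOn.of_gen hs).mul h2, h3,
        by rw [mul_assoc, ← h4, mul_inv_cancel_left], h5⟩
    · push Not at h
      exact ⟨1, k, PosOn.one, PosOn.one, hk, (one_mul k).symm, h⟩

/-- Splitting off the greatest common left divisor. -/
theorem exists_gcd {S : Set Gen} (n : ℕ) : ∀ {x y : Artin}, len x < n → PosOn S x → PosOn S y →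
    ∃ g x' y', PosOn S x' ∧ PosOn S y' ∧ x = g * x' ∧ y = g * y' ∧
      ∀ s, Le (gen s) x' → ¬ Le (gen s) y' := by
  induction n with
  | zero =>
    intro x y hn hx
    have := hx.len_nonneg
    push_cast at hn
    omega
  | succ n ih =>
    intro x y hn hx hy
    by_cases h : ∃ s, Le (gen s) x ∧ Le (gen s) y
    · obtain ⟨s, hsx, hsy⟩ := h
      have hc := PosOn.of_mul (PosOn.of_gen (Set.mem_univ s)) hsx (by simpa using hx)
      have hc' := PosOn.of_mul (PosOn.of_gen (Set.mem_univ s)) hsy (by simpa using hy)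
      obtain ⟨g, x', y', h1, h2, h3, h4, h5⟩ := ih (x := (gen s)⁻¹ * x)
        (by rw [len_inv_gen_mul]; push_cast at hn; omega) hc.2 hc'.2
      exact ⟨gen s * g, x', y', h1, h2, by rw [mul_assoc, ← h3, mul_inv_cancel_left],
        by rw [mul_assoc, ← h4, mul_inv_cancel_left], h5⟩
    · push Not at h
      exact ⟨1, x, y, hx, hy, (one_mul x).symm, (one_mul y).symm, h⟩

theorem not_le_pow_mul {u v : Gen} (hu : u ≠ d) (hv : v ≠ d) (huv : u ≠ v) {y : Artin}
    (hy : PosOn {s | s ≠ v} y) (j : ℕ) : ¬ Le (gen u * gen d) (gen v ^ (j + 1) * y) := by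
  have key {z : Artin} (hz : Pos z) (h : Le (gen u * gen d) (gen v * z)) :
      Le (gen u * (gen d * gen v)) z := by
    have hdu : Le (gen u) (gen u * gen d) := LeOn.mul_right (PosOn.of_gen (Set.mem_univ d)) _
    have h1 := LeOn.comp_le huv hz (hdu.trans h)
    rw [Equi.comp_of_leaf hv hu, wd_cons, wd_nil, mul_one] at h1
    obtain ⟨z', rfl⟩ : ∃ z', z = gen u * z' := ⟨(gen u)⁻¹ * z, by simp⟩
    have hz' : Pos z' := by simpa [LeOn] using h1
    rw [← mul_assoc, gen_comm hv hu, mul_assoc] at h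
    have h2 := LeOn.comp_le hv.symm hz' ((LeOn.mul_left_iff _).1 h)
    rw [Equi.comp_right, wd_cons, wd_cons, wd_nil, mul_one] at h2
    exact h2.mul_left _
  have hp (s : Gen) : Pos (gen s) := PosOn.of_gen (Set.mem_univ s)
  induction j with
  | zero =>
    intro h
    rw [zero_add, pow_one] at h
    have h1 := PosOn.of_le ((hp u).mul ((hp d).mul (hp v))) hy (key hy.pos h)
    have h2 := (PosOn.of_mul (hp u) ((hp d).mul (hp v)) h1).2
    exact not_posOn_gen (by simp) (PosOn.of_mul (hp d) (hp v) h2).2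
  | succ j ih =>
    intro h
    rw [pow_succ', mul_assoc] at h
    have h1 := key (((hp v).pow _).mul hy.pos) h
    rw [← mul_assoc] at h1
    exact ih ((LeOn.mul_right (hp v) _).trans h1)

theorem exists_eq_pow_mul {u v : Gen} (hu : u ≠ d) (hv : v ≠ d) (huv : u ≠ v) {x k : Artin}
    (hx : PosOn {s | s ≠ u} x) (hk : PosOn {s | s ≠ v} k) (hle : Le (gen u) (x * k)) :
    ∃ (i : ℕ) (x' : Artin), x = gen v ^ i * x' ∧ PosOn {s | s ≠ u ∧ s ≠ v} x' := by
  revert hle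
  refine PosOn.induction (motive := fun x => Le (gen u) (x * k) → ∃ (i : ℕ) (x' : Artin),
    x = gen v ^ i * x' ∧ PosOn {s | s ≠ u ∧ s ≠ v} x') ?_ ?_ hx
  · exact fun _ => ⟨0, 1, by simp, PosOn.one⟩
  intro s hs h hh ih hle
  rw [mul_assoc] at hle
  have hpos := hh.pos.mul hk.pos
  have hc := LeOn.comp_le (Ne.symm hs) hpos hle
  by_cases hsd : s = d
  · subst hsd
    rw [Equi.comp_left, wd_cons, wd_cons, wd_nil, mul_one] at hc
    obtain ⟨i, x', rfl, hx'⟩ := ih ((LeOn.mul_right (PosOn.of_gen (Set.mem_univ _)) _).trans hc)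
    match i with
    | 0 => exact ⟨0, gen d * x', by simp, PosOn.mul (PosOn.of_gen (And.intro hs hv.symm)) hx'⟩
    | j + 1 =>
      rw [mul_assoc] at hc
      exact absurd hc (not_le_pow_mul hu hv huv ((hx'.mono fun _ h => h.2).mul hk) j)
  · rw [Equi.comp_of_leaf hsd hu, wd_cons, wd_nil, mul_one] at hc
    obtain ⟨i, x', rfl, hx'⟩ := ih hc
    by_cases hsv : s = v
    · subst hsv
      exact ⟨i + 1, x', by rw [pow_succ', mul_assoc], hx'⟩
    · refine ⟨i, gen s * x', ?_, PosOn.mul (PosOn.of_gen (And.intro hs hsv)) hx'⟩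
      have hc : Commute (gen s) (gen v) := gen_comm hsd hv
      rw [← mul_assoc, ← mul_assoc, (hc.pow_right i).eq]

theorem exists_mul_eq_mul_of_positive {u v w : Gen} (hu : u ≠ d) (hv : v ≠ d) (hw : w ≠ d)
    (huv : u ≠ v) (huw : u ≠ w) (hvw : v ≠ w) {P Q k l : Artin} (hk : PosOn {s | s ≠ v} k)
    (hl : PosOn {s | s ≠ w} l) (hPQ : P⁻¹ * Q ∈ Ahat u) (hkl : (P * k)⁻¹ * (Q * l) ∈ Ahat u)
    (hku : k ∉ Ahat u) : ∃ g ∈ Ahat v, ∃ h ∈ Ahat w, P * g = Q * h := by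
  wlog hred : (∀ s ∈ {s | s ≠ u}, ¬ Le (gen s) k) ∧ ∀ s ∈ {s | s ≠ u}, ¬ Le (gen s) l
    generalizing P Q k l
  · obtain ⟨g, k', h1, h2, h3, rfl, h5⟩ := exists_peel {s | s ≠ u} ((len k).toNat + 1)
      (by push_cast; have := Int.self_le_toNat (len k); omega) hk
    obtain ⟨h, l', j1, j2, j3, rfl, j5⟩ := exists_peel {s | s ≠ u} ((len l).toNat + 1)
      (by push_cast; have := Int.self_le_toNat (len l); omega) hl
    obtain ⟨x, hx, y, hy, e⟩ := this (P := P * g) (Q := Q * h) h3 j3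
      (by
        rw [mul_inv_rev, mul_assoc, ← mul_assoc P⁻¹]
        exact mul_mem (inv_mem h2.mem_Ahat) (mul_mem hPQ j2.mem_Ahat))
      (by simpa only [mul_assoc] using hkl)
      (fun hm => hku (mul_mem h2.mem_Ahat hm)) ⟨h5, j5⟩
    exact ⟨g * x, mul_mem h1.mem_Ahat hx, h * y, mul_mem j1.mem_Ahat hy,
      by simpa only [mul_assoc] using e⟩
  have hG := isGarside_compl hu
  obtain ⟨f, hfP, hfQ⟩ := hG.exists_lower (Ahat_eq u ▸ hPQ)
  obtain ⟨f', x, y, hx, hy, ex, ey, hxy⟩ := exists_gcd ((len (f⁻¹ * P)).toNat + 1)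
      (by push_cast; have := Int.self_le_toNat (len (f⁻¹ * P)); omega) hfP hfQ
  obtain rfl : P = f * f' * x := by rw [mul_assoc, ← ex, mul_inv_cancel_left]
  obtain rfl : Q = f * f' * y := by rw [mul_assoc, ← ey, mul_inv_cancel_left]
  have hxk : (x * k)⁻¹ * (y * l) ∈ Ahat u := by
    convert hkl using 1
    group
  obtain ⟨e, he, he'⟩ := hG.exists_lower (Ahat_eq u ▸ hxk)
  obtain ⟨r, h1, h2, h3, h4⟩ := interpolate (LeOn.one_iff.2 (hx.pos.mul hk.pos)) he.le
    (LeOn.one_iff.2 (hy.pos.mul hl.pos)) he'.le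
  have hr := (LeOn.convex h2 h3 he).2
  rcases (LeOn.one_iff.1 h1).cases with rfl | ⟨s, _, r', hr', rfl⟩
  · have := (LeOn.one_iff.1 hr).mem_Ahat
    exact absurd ((Subgroup.mul_mem_cancel_left _ hx.mem_Ahat).1 this) hku
  have hsx := (LeOn.mul_right hr' (gen s)).trans h3
  have hsy := (LeOn.mul_right hr' (gen s)).trans h4
  by_cases hsu : s = u
  · subst hsu
    obtain ⟨i, x', rfl, hx'⟩ := exists_eq_pow_mul hu hv huv hx hk hsx
    obtain ⟨j, y', rfl, hy'⟩ := exists_eq_pow_mul hu hw huw hy hl hsy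
    refine ⟨x'⁻¹ * gen w ^ j, mul_mem (inv_mem (hx'.mono fun _ h => h.2).mem_Ahat)
      (pow_mem (gen_mem_Ahat hvw.symm) j), y'⁻¹ * gen v ^ i,
      mul_mem (inv_mem (hy'.mono fun _ h => h.2).mem_Ahat) (pow_mem (gen_mem_Ahat hvw) i), ?_⟩
    have hc := ((show Commute (gen v) (gen w) from gen_comm hv hw).pow_pow i j).eq
    simp only [mul_assoc, mul_inv_cancel_left, hc]
  · have h5 := le_of_le_mul hk.pos hred.1 ((len x).toNat + 1)
      (by push_cast; have := Int.self_le_toNat (len x); omega) hx (PosOn.of_gen hsu) hsx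
    have h6 := le_of_le_mul hl.pos hred.2 ((len y).toNat + 1)
      (by push_cast; have := Int.self_le_toNat (len y); omega) hy (PosOn.of_gen hsu) hsy
    exact absurd h6 (hxy s h5)

/-- The transposition of `{0, 1, 2, 3}` attached to a generator, where `u` is the leaf acting on
`{0, 1}`; this folds the other two leaves together. -/
def swapPerm (u s : Gen) : Equiv.Perm (Fin 4) :=
  if s = u then Equiv.swap 0 1 else if s = d then Equiv.swap 1 2 else Equiv.swap 2 3

/-- `1` if the generator moves the point, and `0` otherwise. -/
def moved (u s : Gen) (i : Fin 4) : ℤ := if swapPerm u s i = i then 0 else 1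

theorem swapPerm_swapPerm (u s : Gen) (i : Fin 4) : swapPerm u s (swapPerm u s i) = i := by
  unfold swapPerm
  split_ifs <;> simp

theorem moved_swapPerm (u s : Gen) (i : Fin 4) : moved u s (swapPerm u s i) = moved u s i := by
  unfold moved
  rw [swapPerm_swapPerm]
  simp only [eq_comm]

/-- The action of a generator on points with a move counter. -/
def stepPerm (u s : Gen) : Equiv.Perm (ℤ × Fin 4) where
  toFun x := (x.1 + moved u s x.2, swapPerm u s x.2)
  invFun x := (x.1 - moved u s x.2, swapPerm u s x.2)
  left_inv x := by simp [moved_swapPerm, swapPerm_swapPerm]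
  right_inv x := by simp [moved_swapPerm, swapPerm_swapPerm]

theorem stepPerm_apply (u s : Gen) (n : ℤ) (i : Fin 4) :
    stepPerm u s (n, i) = (n + moved u s i, swapPerm u s i) := rfl

theorem stepPerm_braid {u s t : Gen} (hu : u ≠ d) (hst : s ≠ t) (h : s = d ∨ t = d) :
    stepPerm u s * stepPerm u t * stepPerm u s = stepPerm u t * stepPerm u s * stepPerm u t := by
  have key : ∀ i, swapPerm u s (swapPerm u t (swapPerm u s i)) =
      swapPerm u t (swapPerm u s (swapPerm u t i)) ∧
      moved u s i + moved u t (swapPerm u s i) + moved u s (swapPerm u t (swapPerm u s i)) =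
      moved u t i + moved u s (swapPerm u t i) + moved u t (swapPerm u s (swapPerm u t i)) := by
    cases u <;> cases s <;> cases t <;> first | contradiction | (simp at h; done) | decide
  ext1 ⟨n, i⟩
  simp only [Equiv.Perm.mul_apply, stepPerm_apply, (key i).1, add_assoc n, (key i).2]

theorem stepPerm_comm {u s t : Gen} (hu : u ≠ d) (h : s ≠ d ∧ t ≠ d) :
    stepPerm u s * stepPerm u t = stepPerm u t * stepPerm u s := by
  have key : ∀ i, swapPerm u s (swapPerm u t i) = swapPerm u t (swapPerm u s i) ∧
      moved u t i + moved u s (swapPerm u t i) = moved u s i + moved u t (swapPerm u s i) := by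
    cases u <;> cases s <;> cases t <;> first | contradiction | (simp at h; done) | decide
  ext1 ⟨n, i⟩
  simp only [Equiv.Perm.mul_apply, stepPerm_apply, (key i).1, add_assoc n, (key i).2]

/-- The action of the Artin group on points with a move counter. -/
def act (u : Gen) (hu : u ≠ d) : Artin →* Equiv.Perm (ℤ × Fin 4) :=
  PresentedGroup.toGroup (f := stepPerm u) (by
    rintro _ ⟨s, t, hst, ⟨h, rfl⟩ | ⟨h, rfl⟩⟩
    · rw [map_mul, map_inv, mul_inv_eq_one]
      simpa using stepPerm_braid hu hst h
    · rw [map_mul, map_inv, mul_inv_eq_one, map_mul, map_inv, mul_inv_eq_iff_eq_mul]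
      simpa using stepPerm_comm hu h)

section

variable {u : Gen} (hu : u ≠ d)

theorem act_gen (s : Gen) : act u hu (gen s) = stepPerm u s := PresentedGroup.toGroup.of _

/-- The number of moves made by the point `i`. -/
def crossings (g : Artin) (i : Fin 4) : ℤ := (act u hu g (0, i)).1

/-- The final position of the point `i`. -/
def position (g : Artin) (i : Fin 4) : Fin 4 := (act u hu g (0, i)).2

theorem act_apply (g : Artin) (n : ℤ) (i : Fin 4) :
    act u hu g (n, i) = (n + crossings hu g i, position hu g i) := by
  have hshift : act u hu g ∈ Subgroup.centralizer
      {(Equiv.prodCongr (Equiv.addLeft n) (Equiv.refl (Fin 4)) : Equiv.Perm (ℤ × Fin 4))} := by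
    have hg : g ∈ Subgroup.closure (gen '' Set.univ) := closure_gen ▸ trivial
    refine (Subgroup.closure_le ((Subgroup.centralizer _).comap (act u hu))).2 ?_ hg
    rintro _ ⟨s, _, rfl⟩
    rw [SetLike.mem_coe, Subgroup.mem_comap, act_gen, Subgroup.mem_centralizer_singleton_iff]
    ext1 ⟨k, i⟩
    simp [stepPerm_apply, add_assoc]
  rw [Subgroup.mem_centralizer_singleton_iff] at hshift
  have := DFunLike.congr_fun hshift (0, i)
  simpa [crossings, position, Prod.ext_iff] using this

theorem crossings_mul (g h : Artin) (i : Fin 4) :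
    crossings hu (g * h) i = crossings hu h i + crossings hu g (position hu h i) := by
  rw [crossings, map_mul, Equiv.Perm.mul_apply, act_apply hu h, act_apply hu g]
  simp

theorem position_mul (g h : Artin) (i : Fin 4) :
    position hu (g * h) i = position hu g (position hu h i) := by
  rw [position, map_mul, Equiv.Perm.mul_apply, act_apply hu h, act_apply hu g]

theorem crossings_gen (s : Gen) (i : Fin 4) : crossings hu (gen s) i = moved u s i := by
  simp [crossings, act_gen, stepPerm_apply]

theorem position_gen (s : Gen) (i : Fin 4) : position hu (gen s) i = swapPerm u s i := by
  simp [position, act_gen, stepPerm_apply]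

theorem moved_nonneg (s : Gen) (i : Fin 4) : 0 ≤ moved u s i := by
  unfold moved
  split <;> norm_num

theorem crossings_of_pos {g : Artin} (hg : Pos g) (i : Fin 4) :
    0 ≤ crossings hu g i ∧ (crossings hu g i = 0 → position hu g i = i ∧
      PosOn {s | swapPerm u s i = i} g) := by
  refine PosOn.induction (motive := fun g => 0 ≤ crossings hu g i ∧ (crossings hu g i = 0 →
    position hu g i = i ∧ PosOn {s | swapPerm u s i = i} g)) ?_ ?_ hg
  · simp [crossings, position, PosOn.one]
  intro s _ h _ ih
  rw [crossings_mul, crossings_gen]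
  have hm := moved_nonneg (u := u) s (position hu h i)
  refine ⟨by omega, fun h0 => ?_⟩
  obtain ⟨h1, h2⟩ := ih.2 (by omega)
  have h3 : moved u s i = 0 := by
    rw [h1] at h0 hm
    omega
  have h4 : swapPerm u s i = i := by
    by_contra hne
    simp [moved, hne] at h3
  exact ⟨by rw [position_mul, h1, position_gen, h4], (PosOn.of_gen h4).mul h2⟩

theorem act_of_mem_Ahat {h : Artin} (hh : h ∈ Ahat u) : act u hu h (0, 0) = (0, 0) := by
  rw [Ahat_eq] at hh
  have : Subgroup.closure (gen '' {s | s ≠ u}) ≤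
      (MulAction.stabilizer (Equiv.Perm (ℤ × Fin 4)) ((0, 0) : ℤ × Fin 4)).comap (act u hu) := by
    rw [Subgroup.closure_le]
    rintro _ ⟨s, hs, rfl⟩
    rw [SetLike.mem_coe, Subgroup.mem_comap, act_gen, MulAction.mem_stabilizer_iff,
      Equiv.Perm.smul_def, stepPerm_apply]
    cases u <;> cases s <;> first | contradiction | decide
  exact this hh

theorem crossings_mul_of_mem {g h : Artin} (hh : h ∈ Ahat u) :
    crossings hu (g * h) 0 = crossings hu g 0 := by
  rw [crossings, map_mul, Equiv.Perm.mul_apply, act_of_mem_Ahat hu hh, crossings]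

end

/-- The endomorphism replacing the leaf `v` by the leaf `w`. -/
def fold (v w : Gen) (hv : v ≠ d) (hw : w ≠ d) : Artin →* Artin :=
  PresentedGroup.toGroup (f := fun s => gen (if s = v then w else s)) (by
    rintro _ ⟨s, t, hst, ⟨h, rfl⟩ | ⟨h, rfl⟩⟩
    · rw [map_mul, map_inv, mul_inv_eq_one]
      simp only [map_mul, FreeGroup.lift_apply_of, mul_assoc]
      apply gen_braid
      · cases v <;> cases w <;> cases s <;> cases t <;>
          first | contradiction | (simp at h; done) | decide
      · cases v <;> cases w <;> cases s <;> cases t <;>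
          first | contradiction | (simp at h; done) | decide
    · rw [map_mul, map_inv, mul_inv_eq_one, map_mul, map_inv, mul_inv_eq_iff_eq_mul]
      simp only [map_mul, FreeGroup.lift_apply_of]
      apply gen_comm <;> split <;> simp_all)

section

variable {v w : Gen} (hv : v ≠ d) (hw : w ≠ d)

theorem fold_gen (s : Gen) : fold v w hv hw (gen s) = gen (if s = v then w else s) :=
  PresentedGroup.toGroup.of _

theorem fold_of_mem {g : Artin} (hg : g ∈ Ahat v) : fold v w hv hw g = g := by
  rw [Ahat_eq] at hg
  have : Subgroup.closure (gen '' {s | s ≠ v}) ≤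
      (fold v w hv hw).eqLocus (MonoidHom.id Artin) := by
    rw [Subgroup.closure_le]
    rintro _ ⟨s, hs, rfl⟩
    change fold v w hv hw (gen s) = gen s
    rw [fold_gen, if_neg hs]
  exact this hg

theorem fold_mem {u : Gen} (huw : u ≠ w) {g : Artin} (hg : g ∈ Ahat u) :
    fold v w hv hw g ∈ Ahat u := by
  rw [Ahat_eq] at hg
  have : Subgroup.closure (gen '' {s | s ≠ u}) ≤ (Ahat u).comap (fold v w hv hw) := by
    rw [Subgroup.closure_le]
    rintro _ ⟨s, hs, rfl⟩
    rw [SetLike.mem_coe, Subgroup.mem_comap, fold_gen]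
    split
    · exact gen_mem_Ahat huw.symm
    · exact gen_mem_Ahat hs
  exact this hg

theorem fold_mem_self (hvw : v ≠ w) (g : Artin) : fold v w hv hw g ∈ Ahat v := by
  have hg : g ∈ Subgroup.closure (gen '' Set.univ) := closure_gen ▸ trivial
  refine (Subgroup.closure_le ((Ahat v).comap (fold v w hv hw))).2 ?_ hg
  rintro _ ⟨s, _, rfl⟩
  rw [SetLike.mem_coe, Subgroup.mem_comap, fold_gen]
  split
  · exact gen_mem_Ahat hvw.symm
  · exact gen_mem_Ahat ‹_›

theorem fold_posOn (hvw : v ≠ w) {g : Artin} (hg : Pos g) :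
    PosOn {s | s ≠ v} (fold v w hv hw g) := by
  refine PosOn.induction (motive := fun g => PosOn {s | s ≠ v} (fold v w hv hw g)) ?_ ?_ hg
  · rw [map_one]
    exact PosOn.one
  intro s _ h _ ih
  rw [map_mul, fold_gen]
  refine PosOn.mul (PosOn.of_gen ?_) ih
  split
  · exact hvw.symm
  · assumption

theorem crossings_fold {u : Gen} (hu : u ≠ d) (huv : u ≠ v) (huw : u ≠ w) (g : Artin)
    (i : Fin 4) : crossings hu (fold v w hv hw g) i = crossings hu g i := by
  have h : (act u hu).comp (fold v w hv hw) = act u hu := by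
    refine PresentedGroup.ext fun s => ?_
    change act u hu (fold v w hv hw (gen s)) = act u hu (gen s)
    rw [fold_gen, act_gen, act_gen]
    cases u <;> cases v <;> cases w <;> cases s <;> first | contradiction | rfl
  rw [crossings, crossings, ← MonoidHom.comp_apply, h]

end

/-- Membership in a common coset, by composing two differences. -/
theorem diff_mem {H : Subgroup Artin} {x y z : Artin} (h1 : x⁻¹ * y ∈ H) (h2 : y⁻¹ * z ∈ H) :
    x⁻¹ * z ∈ H := by
  simpa [mul_assoc] using mul_mem h1 h2

theorem diff_symm {H : Subgroup Artin} {x y : Artin} (h : x⁻¹ * y ∈ H) : y⁻¹ * x ∈ H := by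
  simpa using inv_mem h

/-- If `P` minimizes the number of crossings to the coset `p * A_û` among all lower bounds of
elements of `p * A_û` and `q * A_û`, then `P` can only be enlarged without crossings. -/
theorem crossings_eq_zero_of_minimal {u : Gen} (hu : u ≠ d) {p k e P R : Artin} {n : ℤ}
    (hkn : crossings hu k 0 = n) (hk : p⁻¹ * (P * k) ∈ Ahat u) (he : p⁻¹ * e ∈ Ahat u)
    (hPR : Le P R) (hR : n ≤ crossings hu (R⁻¹ * e) 0) :
    crossings hu (P⁻¹ * R) (position hu (R⁻¹ * e) 0) = 0 := by
  have h1 : P⁻¹ * R * (R⁻¹ * e) = k * ((P * k)⁻¹ * e) := by group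
  have h2 := crossings_mul hu (P⁻¹ * R) (R⁻¹ * e) 0
  rw [h1, crossings_mul_of_mem hu (diff_mem (diff_symm hk) he), hkn] at h2
  have := (crossings_of_pos hu hPR (position hu (R⁻¹ * e) 0)).1
  omega

/-- An element fixing a point of `{0, 1}` letter by letter avoids `u`; an element fixing a point
of `{2, 3}` letter by letter avoids the other two leaves. -/
theorem swapPerm_fixed {u v w : Gen} (hu : u ≠ d) (hv : v ≠ d) (hw : w ≠ d) (huv : u ≠ v)
    (huw : u ≠ w) (i : Fin 4) :
    {s | swapPerm u s i = i} ⊆ {s | s ≠ u} ∨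
      {s | swapPerm u s i = i} ⊆ {s | s ≠ v} ∧ {s | swapPerm u s i = i} ⊆ {s | s ≠ w} := by
  have h : (∀ s, swapPerm u s i = i → s ≠ u) ∨
      (∀ s, swapPerm u s i = i → s ≠ v) ∧ ∀ s, swapPerm u s i = i → s ≠ w := by
    have key : (∀ s ∈ [a, b, c, d], swapPerm u s i = i → s ≠ u) ∨
        (∀ s ∈ [a, b, c, d], swapPerm u s i = i → s ≠ v) ∧
          ∀ s ∈ [a, b, c, d], swapPerm u s i = i → s ≠ w := by
      revert i
      cases u <;> cases v <;> cases w <;> first | contradiction | decide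
    have hall : ∀ s : Gen, s ∈ [a, b, c, d] := by
      intro s
      cases s <;> simp
    exact key.imp (fun k s => k s (hall s)) (And.imp (fun k s => k s (hall s))
      fun k s => k s (hall s))
  exact h

theorem exists_mul_eq_mul {u v w : Gen} (hu : u ≠ d) (hv : v ≠ d) (hw : w ≠ d)
    (huv : u ≠ v) (huw : u ≠ w) (hvw : v ≠ w) {p q r t : Artin} (hpq : p⁻¹ * q ∈ Ahat v)
    (hqr : q⁻¹ * r ∈ Ahat u) (hrt : r⁻¹ * t ∈ Ahat w) (htp : t⁻¹ * p ∈ Ahat u)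
    (hne : p⁻¹ * q ∉ Ahat u) : ∃ g ∈ Ahat v, ∃ h ∈ Ahat w, p * g = t * h := by
  classical
  have hex : ∃ n : ℕ, ∃ P e e', Le P e ∧ Le P e' ∧ p⁻¹ * e ∈ Ahat u ∧ q⁻¹ * e' ∈ Ahat u ∧
      (crossings hu (P⁻¹ * e) 0).toNat = n := by
    obtain ⟨P, h1, h2⟩ := exists_lower p q
    exact ⟨_, P, p, q, h1, h2, by simp, by simp, rfl⟩
  obtain ⟨P₀, e, e', hPe, hPe', he, he', hn⟩ := Nat.find_spec hex
  have hmin {R f f' : Artin} (h1 : Le R f) (h2 : Le R f') (h3 : p⁻¹ * f ∈ Ahat u)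
      (h4 : q⁻¹ * f' ∈ Ahat u) : crossings hu (P₀⁻¹ * e) 0 ≤ crossings hu (R⁻¹ * f) 0 := by
    have h5 := Nat.find_min' hex ⟨R, f, f', h1, h2, h3, h4, rfl⟩
    have h6 := (crossings_of_pos hu hPe 0).1
    have h7 := (crossings_of_pos hu h1 0).1
    omega
  set φ := fold v w hv hw with hφ
  set ψ := fold w v hw hv with hψ
  set P := p * φ (p⁻¹ * P₀) with hP
  set Q := t * ψ (t⁻¹ * P₀) with hQ
  have hPk (x : Artin) : P * φ (P₀⁻¹ * x) = p * φ (p⁻¹ * x) := by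
    rw [hP, mul_assoc, ← map_mul, mul_assoc, mul_inv_cancel_left]
  have hQl (x : Artin) : Q * ψ (P₀⁻¹ * x) = t * ψ (t⁻¹ * x) := by
    rw [hQ, mul_assoc, ← map_mul, mul_assoc, mul_inv_cancel_left]
  have hk : p⁻¹ * (P * φ (P₀⁻¹ * e)) ∈ Ahat u := by
    rw [hPk, inv_mul_cancel_left]
    exact fold_mem hv hw huw he
  have hk' : q⁻¹ * (P * φ (P₀⁻¹ * e')) ∈ Ahat u := by
    have h1 : p * φ (p⁻¹ * e') = q * φ (q⁻¹ * e') := by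
      rw [show p⁻¹ * e' = p⁻¹ * q * (q⁻¹ * e') by group, map_mul, hφ, fold_of_mem hv hw hpq]
      group
    rw [hPk, h1, inv_mul_cancel_left]
    exact fold_mem hv hw huw he'
  have hl : p⁻¹ * (Q * ψ (P₀⁻¹ * e)) ∈ Ahat u := by
    refine diff_mem (diff_symm htp) ?_
    rw [hQl, inv_mul_cancel_left]
    exact fold_mem hw hv huv (diff_mem htp he)
  have hl' : q⁻¹ * (Q * ψ (P₀⁻¹ * e')) ∈ Ahat u := by
    have h1 : t * ψ (t⁻¹ * e') = r * ψ (r⁻¹ * e') := by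
      rw [show t⁻¹ * e' = t⁻¹ * r * (r⁻¹ * e') by group, map_mul, hψ,
        fold_of_mem hw hv (diff_symm hrt)]
      group
    refine diff_mem hqr ?_
    rw [hQl, h1, inv_mul_cancel_left]
    exact fold_mem hw hv huv (diff_mem (diff_symm hqr) he')
  have kpos := fold_posOn hv hw hvw hPe
  have kpos' := fold_posOn hv hw hvw hPe'
  have lpos := fold_posOn hw hv hvw.symm hPe
  have lpos' := fold_posOn hw hv hvw.symm hPe'
  have hG := isGarside_compl hu
  obtain ⟨f, hf1, hf2⟩ := hG.exists_upper (Ahat_eq u ▸ diff_mem (diff_symm hk) hl)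
  obtain ⟨f', hf1', hf2'⟩ := hG.exists_upper (Ahat_eq u ▸ diff_mem (diff_symm hk') hl')
  obtain ⟨R, hPR, hQR, hRf, hRf'⟩ := interpolate
    ((LeOn.mul_right kpos.pos P).trans hf1.le) ((LeOn.mul_right lpos.pos Q).trans hf2.le)
    ((LeOn.mul_right kpos'.pos P).trans hf1'.le) ((LeOn.mul_right lpos'.pos Q).trans hf2'.le)
  have hf : p⁻¹ * f ∈ Ahat u := diff_mem hk (PosOn.mem_Ahat hf1)
  have hf' : q⁻¹ * f' ∈ Ahat u := diff_mem hk' (PosOn.mem_Ahat hf1')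
  have hm := hmin hRf hRf' hf hf'
  have hz := ((crossings_of_pos hu hPR _).2 (crossings_eq_zero_of_minimal hu
    (crossings_fold hv hw hu huv huw _ 0) hk hf hPR hm)).2
  have hz' := ((crossings_of_pos hu hQR _).2 (crossings_eq_zero_of_minimal hu
    (crossings_fold hw hv hu huw huv _ 0) hl hf hQR hm)).2
  suffices h : ∃ g ∈ Ahat v, ∃ h ∈ Ahat w, P * g = Q * h by
    obtain ⟨g, hg, h, hh, e⟩ := h
    exact ⟨φ (p⁻¹ * P₀) * g, mul_mem (fold_mem_self hv hw hvw _) hg, ψ (t⁻¹ * P₀) * h,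
      mul_mem (fold_mem_self hw hv hvw.symm _) hh, by rw [← mul_assoc, ← mul_assoc, ← hP, ← hQ, e]⟩
  rcases swapPerm_fixed hu hv hw huv huw (position hu (R⁻¹ * f) 0) with h | ⟨h, h'⟩
  · have hPQ : P⁻¹ * Q ∈ Ahat u :=
      diff_mem (hz.mono h).mem_Ahat (diff_symm (hz'.mono h).mem_Ahat)
    by_cases hku : φ (P₀⁻¹ * e) ∈ Ahat u
    · have hku' : φ (P₀⁻¹ * e') ∉ Ahat u := fun hku' => hne (diff_mem hk (diff_mem
        (diff_mem (y := P) (by simpa using inv_mem hku) (by simpa using hku')) (diff_symm hk')))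
      exact exists_mul_eq_mul_of_positive hu hv hw huv huw hvw kpos' lpos' hPQ
        (diff_mem (diff_symm hk') hl') hku'
    · exact exists_mul_eq_mul_of_positive hu hv hw huv huw hvw kpos lpos hPQ
        (diff_mem (diff_symm hk) hl) hku
  · exact ⟨P⁻¹ * R, (hz.mono h).mem_Ahat, Q⁻¹ * R, (hz'.mono h').mem_Ahat, by
      rw [mul_inv_cancel_left, mul_inv_cancel_left]⟩

theorem IsCosetOf.inv_mul_mem {X : Set Artin} {H : Subgroup Artin} (hX : IsCosetOf X H)
    {x y : Artin} (hx : x ∈ X) (hy : y ∈ X) : x⁻¹ * y ∈ H := by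
  obtain ⟨g, rfl⟩ := hX
  rw [Set.mem_smul_set_iff_inv_smul_mem, smul_eq_mul, SetLike.mem_coe] at hx hy
  exact diff_mem (y := g) (by simpa using inv_mem hx) hy

theorem IsCosetOf.mul_mem {X : Set Artin} {H : Subgroup Artin} (hX : IsCosetOf X H)
    {x h : Artin} (hx : x ∈ X) (hh : h ∈ H) : x * h ∈ X := by
  obtain ⟨g, rfl⟩ := hX
  rw [Set.mem_smul_set_iff_inv_smul_mem, smul_eq_mul, SetLike.mem_coe] at hx ⊢
  rw [← mul_assoc]
  exact Subgroup.mul_mem _ hx hh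

theorem IsCosetOf.eq_of_inv_mul_mem {X Y : Set Artin} {H : Subgroup Artin} (hX : IsCosetOf X H)
    (hY : IsCosetOf Y H) {x y : Artin} (hx : x ∈ X) (hy : y ∈ Y) (h : x⁻¹ * y ∈ H) : X = Y := by
  ext z
  refine ⟨fun hz => ?_, fun hz => ?_⟩
  · simpa using hY.mul_mem hy (diff_mem (diff_symm h) (hX.inv_mul_mem hx hz))
  · simpa using hX.mul_mem hx (diff_mem h (hY.inv_mul_mem hy hz))

end D4Artin

/-- In an embedded 4-cycle of the `D₄` Artin complex with all vertex types among
`{â, b̂, ĉ}`, where opposite vertices `x₁, x₃` have the same type `û` and the other two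
vertices have the remaining two distinct types, the vertices `x₂` and `x₄` are adjacent. -/
theorem opposite_adjacent_of_four_cycle
    (u v w : Gen) (hu : u ≠ d) (hv : v ≠ d) (hw : w ≠ d)
    (huv : u ≠ v) (huw : u ≠ w) (hvw : v ≠ w)
    (x1 x2 x3 x4 : Set Artin)
    (hx1 : IsCosetOf x1 (Ahat u)) (hx3 : IsCosetOf x3 (Ahat u))
    (hx2 : IsCosetOf x2 (Ahat v)) (hx4 : IsCosetOf x4 (Ahat w))
    (h13 : x1 ≠ x3)
    (h12 : (x1 ∩ x2).Nonempty) (h23 : (x2 ∩ x3).Nonempty)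
    (h34 : (x3 ∩ x4).Nonempty) (h41 : (x4 ∩ x1).Nonempty) :
    (x2 ∩ x4).Nonempty := by
  obtain ⟨p, hp1, hp2⟩ := h12
  obtain ⟨q, hq2, hq3⟩ := h23
  obtain ⟨r, hr3, hr4⟩ := h34
  obtain ⟨t, ht4, ht1⟩ := h41
  obtain ⟨g, hg, h, hh, e⟩ := exists_mul_eq_mul hu hv hw huv huw hvw
    (hx2.inv_mul_mem hp2 hq2) (hx3.inv_mul_mem hq3 hr3) (hx4.inv_mul_mem hr4 ht4)
    (hx1.inv_mul_mem ht1 hp1) fun hm => h13 (hx1.eq_of_inv_mul_mem hx3 hp1 hq3 hm)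
  exact ⟨p * g, hx2.mul_mem hp2 hg, e ▸ hx4.mul_mem ht4 hh⟩
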